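/- For every D ⊆ U^{|z|} and small A ⊆ U, the following are equivalent: (1) o(D/A) has cardinality < κ; (2) o(D/A) has cardinality ≤ 2^(2^|L(A)|). -/

import Mathlib

namespace Paper

open FirstOrder Language Cardinal Set

universe u

variable (L : FirstOrder.Language.{u, u}) (U : Type u) [iS : L.Structure U]

/-- A language consisting of a single `n`-ary relation symbol. -/
def predLang (n : ℕ) : FirstOrder.Language.{u, u} where
  Functions := fun _ => PEmpty
  Relations := fun m => ULift (PLift (m = n))

/-- The language `L` together with one new `n`-ary relation symbol. -/
def expLang (n : ℕ) : FirstOrder.Language.{u, u} := L.sum (predLang n)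

/-- The expansion `⟨U, D⟩` of `U` by a predicate for `D ⊆ U^n`. -/
def expStr {n : ℕ} (D : Set (Fin n → U)) : (expLang L n).Structure U where
  funMap := fun {_} f x =>
    match f with
    | Sum.inl f => Structure.funMap f x
    | Sum.inr f => f.elim
  RelMap := fun {_} r x =>
    match r with
    | Sum.inl r => Structure.RelMap r x
    | Sum.inr h => (x ∘ Fin.cast h.down.down.symm) ∈ D

/-- Add the elements of `A : Set U` as constants to an arbitrary structure on `U`. -/
def addConsts {L' : FirstOrder.Language.{u, u}} (S : L'.Structure U) (A : Set U) :
    (L'[[↥A]]).Structure U :=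
  letI := S
  letI : (constantsOn ↥A).Structure U := constantsOn.structure Subtype.val
  Language.sumStructure _ _ _

/-- Add all elements of `U` as constants to an arbitrary structure on `U`. -/
def addAllConsts {L' : FirstOrder.Language.{u, u}} (S : L'.Structure U) :
    (L'[[U]]).Structure U :=
  letI := S
  letI : (constantsOn U).Structure U := constantsOn.structure id
  Language.sumStructure _ _ _

/-- Realization of a formula with respect to an explicitly given structure. -/
def FRealize {L' : FirstOrder.Language.{u, u}} (S : L'.Structure U) {α : Type*}
    (φ : L'.Formula α) (v : α → U) : Prop :=
  @Formula.Realize L' U S α φ v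

/-- Realization of a sentence with respect to an explicitly given structure. -/
def SentRealize {L' : FirstOrder.Language.{u, u}} (S : L'.Structure U) (φ : L'.Sentence) : Prop :=
  @Sentence.Realize L' U S φ

/-- A structure on `U` is saturated if every type over a parameter set of cardinality `< #U`
which is finitely realized is realized. -/
def IsSatStr {L' : FirstOrder.Language.{u, u}} (S : L'.Structure U) : Prop :=
  ∀ A : Set U, #A < #U → ∀ (m : ℕ) (p : Set ((L'[[↥A]]).Formula (Fin m))),
    (∀ s : Finset ((L'[[↥A]]).Formula (Fin m)), ↑s ⊆ p →
      ∃ b : Fin m → U, ∀ φ ∈ s, FRealize U (addConsts U S A) φ b) →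
    ∃ b : Fin m → U, ∀ φ ∈ p, FRealize U (addConsts U S A) φ b

/-- `D ⊆ U^n` is saturated if the expansion `⟨U, D⟩` is a saturated structure. -/
def SatSet {n : ℕ} (D : Set (Fin n → U)) : Prop :=
  IsSatStr U (expStr L U D)

/-- `⟨U,C⟩ ≡_A ⟨U,D⟩` : the two expansions satisfy the same sentences with parameters in `A`. -/
def EqvOver {n : ℕ} (A : Set U) (C D : Set (Fin n → U)) : Prop :=
  ∀ φ : ((expLang L n)[[↥A]]).Sentence,
    SentRealize U (addConsts U (expStr L U C) A) φ ↔
      SentRealize U (addConsts U (expStr L U D) A) φ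

/-- `e(D/A)`, the class of all `C` with `⟨U,C⟩ ≡_A ⟨U,D⟩`. -/
def eSet {n : ℕ} (A : Set U) (D : Set (Fin n → U)) : Set (Set (Fin n → U)) :=
  {C | EqvOver L U A C D}

/-- The group `Aut(U/A)` of automorphisms of `U` fixing `A` pointwise (as a set). -/
def AutFix (A : Set U) : Set (U ≃[L] U) :=
  {f | ∀ a ∈ A, f a = a}

/-- The image of a set of tuples under an automorphism. -/
def imgSet {n : ℕ} (f : U ≃[L] U) (D : Set (Fin n → U)) : Set (Fin n → U) :=
  (fun b => ⇑f ∘ b) '' D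

/-- The orbit `o(D/A)` of `D` under `Aut(U/A)`. -/
def oSet {n : ℕ} (A : Set U) (D : Set (Fin n → U)) : Set (Set (Fin n → U)) :=
  {C | ∃ f ∈ AutFix L U A, imgSet L U f D = C}

/-- The orbit `o(b/A)` of a tuple `b` under `Aut(U/A)`. -/
def oTuple {n : ℕ} (A : Set U) (b : Fin n → U) : Set (Fin n → U) :=
  {c | ∃ f ∈ AutFix L U A, ⇑f ∘ b = c}

/-- A family of sets shatters `B` if every subset of `B` is the trace of a member. -/
def Shatters {α : Type*} (u : Set (Set α)) (B : Set α) : Prop :=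
  ∀ H ⊆ B, ∃ D ∈ u, D ∩ B = H

/-- A family of sets has finite VC dimension if for some `N` it shatters no `N`-element set. -/
def FiniteVC {α : Type*} (u : Set (Set α)) : Prop :=
  ∃ N : ℕ, ∀ B : Finset α, B.card = N → ¬Shatters u ↑B

/-- `B^{|z|}`, the set of tuples with coordinates in `B`. -/
def tuplesIn {n : ℕ} (B : Set U) : Set (Fin n → U) :=
  {a | ∀ i, a i ∈ B}

/-- `φ(b, U)`, the set defined by `φ(x,z)` with `x ↦ b`. -/
def phiSet {m n : ℕ} (φ : L.Formula (Fin m ⊕ Fin n)) (b : Fin m → U) :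
    Set (Fin n → U) :=
  {a | φ.Realize (Sum.elim b a)}

/-- `D` is approximable by `φ(x,z)` : every finite trace of `D` is the trace of
some instance `φ(b,U)`. -/
def ApproxBy {n : ℕ} (D : Set (Fin n → U)) {m : ℕ} (φ : L.Formula (Fin m ⊕ Fin n)) : Prop :=
  ∀ B : Finset U, ∃ b : Fin m → U,
    phiSet L U φ b ∩ tuplesIn U ↑B = D ∩ tuplesIn U ↑B

/-- `D` is approximable from below by `φ(x,z)`. -/
def ApproxBelowBy {n : ℕ} (D : Set (Fin n → U)) {m : ℕ}
    (φ : L.Formula (Fin m ⊕ Fin n)) : Prop :=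
  ∀ B : Finset U, ∃ b : Fin m → U,
    phiSet L U φ b ∩ tuplesIn U ↑B = D ∩ tuplesIn U ↑B ∧ phiSet L U φ b ⊆ D

/-- `D` is approximable from above by `φ(x,z)`. -/
def ApproxAboveBy {n : ℕ} (D : Set (Fin n → U)) {m : ℕ}
    (φ : L.Formula (Fin m ⊕ Fin n)) : Prop :=
  ∀ B : Finset U, ∃ b : Fin m → U,
    phiSet L U φ b ∩ tuplesIn U ↑B = D ∩ tuplesIn U ↑B ∧ D ⊆ phiSet L U φ b

def Approximable {n : ℕ} (D : Set (Fin n → U)) : Prop :=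
  ∃ (m : ℕ) (φ : L.Formula (Fin m ⊕ Fin n)), ApproxBy L U D φ

def ApproxBelow {n : ℕ} (D : Set (Fin n → U)) : Prop :=
  ∃ (m : ℕ) (φ : L.Formula (Fin m ⊕ Fin n)), ApproxBelowBy L U D φ

def ApproxAbove {n : ℕ} (D : Set (Fin n → U)) : Prop :=
  ∃ (m : ℕ) (φ : L.Formula (Fin m ⊕ Fin n)), ApproxAboveBy L U D φ

/-- The formula `φ(x, a)` (an `L(U)`-formula in the variables `x`), obtained by
substituting the tuple `a` for the variables `z` in `φ(x,z)`. -/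
def instFormula {m n : ℕ} (φ : L.Formula (Fin m ⊕ Fin n)) (a : Fin n → U) :
    (L[[U]]).Formula (Fin m) :=
  ((L.lhomWithConstants U).onFormula φ).subst
    (Sum.elim (fun i => Term.var i) (fun j => (L.con (a j)).term))

/-- A (complete) global type in the variables `x = (x_0, ..., x_{m-1})` : a maximal
finitely realized set of `L(U)`-formulas. -/
def IsGlobalType {m : ℕ} (p : Set ((L[[U]]).Formula (Fin m))) : Prop :=
  (∀ s : Finset ((L[[U]]).Formula (Fin m)), ↑s ⊆ p →
    ∃ b : Fin m → U, ∀ φ ∈ s, FRealize U (addAllConsts U iS) φ b) ∧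
  ∀ φ : (L[[U]]).Formula (Fin m), φ ∈ p ↔ φ.not ∉ p

/-- `D` is externally definable: `D = {a : φ(x,a) ∈ p}` for some global type `p` and
formula `φ(x,z)`. -/
def ExtDefinable {n : ℕ} (D : Set (Fin n → U)) : Prop :=
  ∃ (m : ℕ) (φ : L.Formula (Fin m ⊕ Fin n)) (p : Set ((L[[U]]).Formula (Fin m))),
    IsGlobalType L U p ∧ D = {a | instFormula L U φ a ∈ p}

/-- A sequence of `n`-tuples is indiscernible with respect to the formulas of a
structure `S` on `U`. -/
def IndiscIn {L' : FirstOrder.Language.{u, u}} (S : L'.Structure U) {n : ℕ} {I : Type*} [LinearOrder I]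
    (a : I → Fin n → U) : Prop :=
  ∀ (k : ℕ) (i j : Fin k → I), StrictMono i → StrictMono j →
    ∀ φ : L'.Formula (Fin k × Fin n),
      FRealize U S φ (fun q => a (i q.1) q.2) ↔ FRealize U S φ (fun q => a (j q.1) q.2)

/-- An `A`-indiscernible sequence of `n`-tuples. -/
def IndiscOver {n : ℕ} (A : Set U) {I : Type*} [LinearOrder I] (a : I → Fin n → U) : Prop :=
  IndiscIn U (addConsts U iS A) a


/-- `D` is Lascar invariant over `A` : `D` is invariant over every small model containing `A`. -/
def LascarInv {n : ℕ} (A : Set U) (D : Set (Fin n → U)) : Prop :=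
  ∀ M : L.ElementarySubstructure U, A ⊆ (M : L.Substructure U) →
    #((M : L.Substructure U) : Set U) < #U →
    ∀ f ∈ AutFix L U ((M : L.Substructure U) : Set U), imgSet L U f D = D

/-- The cardinality of the set `L(A)` of formulas with parameters in `A`. -/
def formulaCard (A : Set U) : Cardinal.{u} :=
  #(Σ k : ℕ, (L[[↥A]]).Formula (Fin k))

/-- `u` locally covers `B` (relative to the cardinal `κ`). -/
def LocallyCovers {α : Type u} (κ : Cardinal.{u}) (u : Set (Set α)) (B : Set α) : Prop :=
  ∀ K : Set α, K ⊆ B → #K = κ → ∀ k : ℕ, ∃ D ∈ u, (k : Cardinal.{u}) ≤ #(↥(K ∩ D))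

/-- `φ(x, b)` divides over `A` : for some infinite `K ⊆ o(b/A)` and some `k`,
`{φ(x,c) : c ∈ K}` is `k`-inconsistent. -/
def Divides {m n : ℕ} (φ : L.Formula (Fin m ⊕ Fin n)) (b : Fin n → U) (A : Set U) : Prop :=
  ∃ K : Set (Fin n → U), K ⊆ oTuple L U A b ∧ K.Infinite ∧
    ∃ k : ℕ, ∀ s : Finset (Fin n → U), ↑s ⊆ K → s.card = k →
      ¬∃ x : Fin m → U, ∀ c ∈ s, φ.Realize (Sum.elim x c)

/-- `C` is pseudo-invariant over `A` : `e(C)` locally covers `o(b/A)` for every `b ∈ C`. -/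
def PseudoInv {k : ℕ} (A : Set U) (C : Set (Fin k → U)) : Prop :=
  ∀ b ∈ C, LocallyCovers (#U) (eSet L U (∅ : Set U) C) (oTuple L U A b)

/-- A family `u` of subsets of `U^n` is closed: it is cut out by a set of sentences with a
second-order variable, i.e. sentences of the language expanded by a predicate. -/
def ClosedFam {n : ℕ} (u : Set (Set (Fin n → U))) : Prop :=
  ∃ p : Set ((expLang L n).Sentence),
    u = {D | ∀ φ ∈ p, SentRealize U (expStr L U D) φ}

/-- `κ` is a Ramsey cardinal : every `2`-coloring of the finite subsets of a set of size `κ`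
has a homogeneous set of size `κ`. -/
def IsRamseyCard (κ : Cardinal.{u}) : Prop :=
  ∀ (X : Type u), #X = κ → ∀ c : Finset X → Bool,
    ∃ H : Set X, #H = κ ∧
      ∀ s t : Finset X, ↑s ⊆ H → ↑t ⊆ H → s.card = t.card → c s = c t

/-- The formula `φ(x,z)` is NIP: the family of its instances `φ(a,U)` has finite
VC dimension. -/
def FormulaNIP {m n : ℕ} (φ : L.Formula (Fin m ⊕ Fin n)) : Prop :=
  FiniteVC {E : Set (Fin n → U) | ∃ b : Fin m → U, E = phiSet L U φ b}

/-- The theory of `U` is NIP: every formula is NIP. -/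
def TheoryNIP : Prop :=
  ∀ (m n : ℕ) (φ : L.Formula (Fin m ⊕ Fin n)), FormulaNIP L U φ

/-- A global type `p(z)` is invariant over `A` : each of the sets `D_{p,φ}` is fixed
(setwise) by every automorphism fixing `A` pointwise. -/
def GlobalTypeInv {n : ℕ} (A : Set U) (p : Set ((L[[U]]).Formula (Fin n))) : Prop :=
  ∀ (k : ℕ) (φ : L.Formula (Fin n ⊕ Fin k)) (f : U ≃[L] U), f ∈ AutFix L U A →
    imgSet L U f {a | instFormula L U φ a ∈ p} = {a | instFormula L U φ a ∈ p}

/-- `M` (a subset of `U`) is `L(A;C)`-saturated : every finitely realized type `p(x) ⊆ L(A;C)`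
is realized by a tuple from `M`. -/
def LACSat {n : ℕ} (C : Set (Fin n → U)) (A : Set U) (M : Set U) : Prop :=
  ∀ (m : ℕ) (p : Set (((expLang L n)[[↥A]]).Formula (Fin m))),
    (∀ s : Finset (((expLang L n)[[↥A]]).Formula (Fin m)), ↑s ⊆ p →
      ∃ b : Fin m → U, ∀ φ ∈ s, FRealize U (addConsts U (expStr L U C) A) φ b) →
    ∃ b : Fin m → U, (∀ i, b i ∈ M) ∧
      ∀ φ ∈ p, FRealize U (addConsts U (expStr L U C) A) φ b

/-- The inclusion of languages `L(M) → L(U)` for `M : Set U`. -/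
def liftConsts (M : Set U) : (L[[↥M]]) →ᴸ (L[[U]]) :=
  LHom.sumMap (LHom.id L) (LHom.constantsOnMap Subtype.val)

section Homogeneity

variable {L U}

theorem IsSatStr.exists_realize (hsat : IsSatStr U iS) {I : Type u} (hI : #I < #U) (e : I → U)
    {m : ℕ} (p : Set (L.Formula (I ⊕ Fin m)))
    (hp : ∀ s : Finset (L.Formula (I ⊕ Fin m)), ↑s ⊆ p →
      ∃ b : Fin m → U, ∀ φ ∈ s, φ.Realize (Sum.elim e b)) :
    ∃ b : Fin m → U, ∀ φ ∈ p, φ.Realize (Sum.elim e b) := by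
  classical
  let t : L.Formula (I ⊕ Fin m) → (L[[↥(range e)]]).Formula (Fin m) := fun φ =>
    BoundedFormula.constantsVarsEquiv.symm (φ.relabel (Sum.map (rangeFactorization e) id))
  have ht : ∀ φ b, FRealize U (addConsts U iS (range e)) (t φ) b ↔
      φ.Realize (Sum.elim e b) := by
    intro φ b
    let _ : (constantsOn ↥(range e)).Structure U := constantsOn.structure Subtype.val
    refine (BoundedFormula.realize_constantsVarsEquiv (L := L) (α := ↥(range e))
      (φ := t φ) (v := b)).symm.trans ?_
    simp only [t, _root_.Equiv.apply_symm_apply]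
    refine Formula.realize_relabel.trans (iff_of_eq (congrArg _ ?_))
    ext (i | j) <;> rfl
  obtain ⟨b, hb⟩ := hsat (range e) (mk_range_le.trans_lt hI) m (t '' p) fun s hs => by
    obtain ⟨s', hs', rfl⟩ := Finset.subset_set_image_iff.1 hs
    obtain ⟨b, hb⟩ := hp s' hs'
    refine ⟨b, fun φ hφ => ?_⟩
    obtain ⟨ψ, hψ, rfl⟩ := Finset.mem_image.1 hφ
    exact (ht ψ b).2 (hb ψ hψ)
  exact ⟨b, fun φ hφ => (ht φ b).1 (hb _ (mem_image_of_mem t hφ))⟩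

variable (L) in
/-- A relation on `U` which preserves the truth of all `L`-formulas (a partial elementary map). -/
def IsElemRel (R : Set (U × U)) : Prop :=
  ∀ φ : L.Formula R, φ.Realize (fun r => r.1.1) ↔ φ.Realize (fun r => r.1.2)

theorem IsElemRel.realize_iff {R : Set (U × U)} (hR : IsElemRel L R) {I : Type*} {e e' : I → U}
    (h : ∀ i, (e i, e' i) ∈ R) (φ : L.Formula I) : φ.Realize e ↔ φ.Realize e' := by
  have := hR (φ.relabel fun i => ⟨_, h i⟩)
  rw [Formula.realize_relabel, Formula.realize_relabel] at this
  exact this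

theorem isElemRel_range {I : Type*} {e e' : I → U}
    (h : ∀ φ : L.Formula I, φ.Realize e ↔ φ.Realize e') :
    IsElemRel L (range fun i => (e i, e' i)) := by
  intro φ
  have hs := fun r : ↥(range fun i => (e i, e' i)) => r.2.choose_spec
  have := h (φ.relabel fun r => r.2.choose)
  simp only [Formula.realize_relabel] at this
  convert this using 2
  · exact funext fun r => (congrArg Prod.fst (hs r)).symm
  · exact funext fun r => (congrArg Prod.snd (hs r)).symm

theorem IsElemRel.swap {R : Set (U × U)} (hR : IsElemRel L R) :
    IsElemRel L (Prod.swap '' R) := by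
  have := isElemRel_range (I := R) (e := fun r => r.1.2) (e' := fun r => r.1.1)
    fun φ => (hR φ).symm
  rwa [image_eq_range]

theorem IsElemRel.mono {R S : Set (U × U)} (hR : IsElemRel L R) (h : S ⊆ R) :
    IsElemRel L S :=
  fun φ => hR.realize_iff (fun r => h r.2) φ

theorem isElemRel_of_finite {R : Set (U × U)}
    (h : ∀ S ⊆ R, S.Finite → IsElemRel L S) : IsElemRel L R := by
  classical
  intro φ
  let S : Set (U × U) := Subtype.val '' (φ.freeVarFinset : Set R)
  have hS := h S (by rintro _ ⟨r, -, rfl⟩; exact r.2) ((Finset.finite_toSet _).image _)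
  have := hS.realize_iff (e := fun r : φ.freeVarFinset => r.1.1.1) (e' := fun r => r.1.1.2)
    (fun r => ⟨r.1, r.2, rfl⟩) (φ.restrictFreeVar id)
  exact (BoundedFormula.realize_restrictFreeVar (f := id) (fun r : R => r.1.1)
    fun _ => rfl).symm.trans (this.trans
      (BoundedFormula.realize_restrictFreeVar (f := id) (fun r : R => r.1.2) fun _ => rfl))

theorem IsElemRel.exists_insert (hsat : IsSatStr U iS) {R : Set (U × U)} (hR : IsElemRel L R)
    (hcard : #R < #U) (x : U) : ∃ y, IsElemRel L (insert (x, y) R) := by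
  classical
  let p : Set (L.Formula (R ⊕ Fin 1)) := {φ | φ.Realize (Sum.elim (fun r => r.1.1) fun _ => x)}
  obtain ⟨b, hb⟩ := hsat.exists_realize hcard (fun r => r.1.2) p fun s hs => by
    have := (hR (Formula.iExs (Fin 1) (Formula.iInf fun φ : s => φ.1))).1
    simp only [Formula.realize_iExs, Formula.realize_iInf] at this
    obtain ⟨b, hb⟩ := this ⟨fun _ => x, fun φ => hs φ.2⟩
    exact ⟨b, fun φ hφ => hb ⟨φ, hφ⟩⟩
  have := isElemRel_range (L := L) (I := R ⊕ Fin 1) (e := Sum.elim (fun r => r.1.1) fun _ => x)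
    (e' := Sum.elim (fun r => r.1.2) b) fun φ => by
      refine ⟨hb φ, fun h => ?_⟩
      by_contra h'
      exact Formula.realize_not.1 (hb φ.not (Formula.realize_not.2 h')) h
  refine ⟨b 0, this.mono ?_⟩
  rintro r (rfl | hr)
  · exact ⟨Sum.inr 0, rfl⟩
  · exact ⟨Sum.inl ⟨r, hr⟩, rfl⟩

theorem IsElemRel.exists_step (hsat : IsSatStr U iS) (hinf : ℵ₀ ≤ #U) {R : Set (U × U)}
    (hR : IsElemRel L R) (hcard : #R < #U) (x : U) :
    ∃ q : U × U, IsElemRel L (R ∪ {(x, q.1), (q.2, x)}) := by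
  obtain ⟨y, hy⟩ := hR.exists_insert hsat hcard x
  have hc : #↥(Prod.swap '' insert (x, y) R) < #U :=
    mk_image_le.trans_lt ((mk_insert_le).trans_lt
      (add_lt_of_lt hinf hcard (one_lt_aleph0.trans_le hinf)))
  obtain ⟨z, hz⟩ := hy.swap.exists_insert hsat hc x
  refine ⟨(y, z), hz.swap.mono ?_⟩
  rintro r (hr | rfl | rfl)
  · exact ⟨r.swap, Or.inr ⟨r, Or.inr hr, rfl⟩, rfl⟩
  · exact ⟨(y, x), Or.inr ⟨(x, y), Or.inl rfl, rfl⟩, rfl⟩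
  · exact ⟨(x, z), Or.inl rfl, rfl⟩

theorem IsElemRel.exists_equiv {R : Set (U × U)} (hR : IsElemRel L R)
    (hdom : ∀ x, ∃ y, (x, y) ∈ R) (hran : ∀ y, ∃ x, (x, y) ∈ R) :
    ∃ f : U ≃[L] U, ∀ r ∈ R, f r.1 = r.2 := by
  choose f hf using hdom
  choose g hg using hran
  have heq : ∀ {x y x' y'}, (x, y) ∈ R → (x', y') ∈ R → (x = x' ↔ y = y') := by
    intro x y x' y' h h'
    have := hR.realize_iff (e := ![x, x']) (e' := ![y, y'])
      (fun i => by fin_cases i <;> assumption)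
      (Term.equal (Term.var (0 : Fin 2)) (Term.var 1) : L.Formula (Fin 2))
    simpa using this
  have hfun : ∀ r ∈ R, f r.1 = r.2 := fun r hr => (heq (hf r.1) hr).1 rfl
  refine ⟨⟨⟨f, g, fun x => (heq (hg _) (hf x)).2 rfl, fun y => hfun _ (hg y)⟩, ?_, ?_⟩, hfun⟩
  · intro k F x
    have := hR.realize_iff (e := Fin.cons (Structure.funMap F x) x) (e' := Fin.cons (f (Structure.funMap F x)) (f ∘ x))
      (fun i => by refine Fin.cases ?_ (fun i => ?_) i <;> exact hf _) (Formula.graph F)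
    rw [Formula.realize_graph, Formula.realize_graph] at this
    exact (this.1 rfl).symm
  · intro k r x
    exact (hR.realize_iff (e := x) (e' := f ∘ x) (fun i => hf _) (r.formula Term.var)).symm

theorem IsElemRel.exists_automorphism (hsat : IsSatStr U iS) (hinf : ℵ₀ < #U)
    {R : Set (U × U)} (hR : IsElemRel L R) (hcard : #R < #U) :
    ∃ f : U ≃[L] U, ∀ r ∈ R, f r.1 = r.2 := by
  classical
  obtain ⟨lt, wo, hlt⟩ := exists_ord_eq U
  let step : U → Set (U × U) → Set (U × U) := fun x S =>
    if h : ∃ q : U × U, IsElemRel L (S ∪ {(x, q.1), (q.2, x)}) then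
      {(x, h.choose.1), (h.choose.2, x)} else ∅
  have step_countable : ∀ x S, #(step x S) ≤ ℵ₀ := by
    intro x S
    rw [mk_le_aleph0_iff]
    dsimp only [step]
    split_ifs
    · exact ((finite_singleton _).insert _).countable
    · exact countable_empty
  let g : U → Set (U × U) := wo.wf.fix fun x ih => step x (R ∪ ⋃ y, ⋃ h : lt y x, ih y h)
  let below : U → Set (U × U) := fun x => R ∪ ⋃ y, ⋃ _ : lt y x, g y
  have hg : ∀ x, g x = step x (below x) := fun x => wo.wf.fix_eq _ x
  have below_card : ∀ x, #(below x) < #U := by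
    intro x
    refine (mk_union_le _ _).trans_lt (add_lt_of_lt hinf.le hcard ?_)
    refine (mk_biUnion_le g {y | lt y x}).trans_lt ((mul_le_mul_right
      (ciSup_le' fun y => (hg y.1).symm ▸ step_countable _ _) _).trans_lt
      (mul_lt_of_lt hinf.le ?_ hinf))
    exact card_typein_lt x hlt
  have below_mono : ∀ {x y}, lt x y → below x ∪ g x ⊆ below y := by
    intro x y hxy
    refine union_subset (union_subset_union_right _ ?_) (subset_union_of_subset_right ?_ _)
    · exact iUnion₂_subset fun z hz => subset_iUnion₂_of_subset z (_root_.trans hz hxy) subset_rfl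
    · exact subset_iUnion₂_of_subset x hxy subset_rfl
  have elem_union : ∀ P : U → Prop, (∀ y, P y → IsElemRel L (below y ∪ g y)) →
      IsElemRel L (R ∪ ⋃ y, ⋃ _ : P y, g y) := by
    intro P hP
    refine isElemRel_of_finite fun S hS hfin => ?_
    have : S ⊆ R ∨ ∃ y, P y ∧ S ⊆ below y ∪ g y := by
      induction S, hfin using Set.Finite.induction_on with
      | empty => exact Or.inl (empty_subset _)
      | @insert r S _ _ ih =>
        rw [insert_subset_iff] at hS
        have hRb : ∀ y, R ⊆ below y ∪ g y := fun y =>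
          subset_union_left.trans subset_union_left
        rcases hS.1 with hr | hr
        · rcases ih hS.2 with h | ⟨y, hy, h⟩
          · exact Or.inl (insert_subset hr h)
          · exact Or.inr ⟨y, hy, insert_subset (hRb y hr) h⟩
        · obtain ⟨z, hz, hr⟩ := mem_iUnion₂.1 hr
          rcases ih hS.2 with h | ⟨y, hy, h⟩
          · exact Or.inr ⟨z, hz, insert_subset (Or.inr hr) (h.trans (hRb z))⟩
          · rcases trichotomous_of lt y z with hyz | rfl | hyz
            · exact Or.inr ⟨z, hz, insert_subset (Or.inr hr)
                (h.trans ((below_mono hyz).trans subset_union_left))⟩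
            · exact Or.inr ⟨y, hy, insert_subset (Or.inr hr) h⟩
            · exact Or.inr ⟨y, hy, insert_subset (Or.inl (below_mono hyz (Or.inr hr))) h⟩
    rcases this with h | ⟨y, hy, h⟩
    · exact hR.mono h
    · exact (hP y hy).mono h
  have elem_step : ∀ x, IsElemRel L (below x) →
      IsElemRel L (below x ∪ g x) ∧ (∃ y, (x, y) ∈ g x) ∧ ∃ y, (y, x) ∈ g x := by
    intro x hx
    have h := hx.exists_step hsat hinf.le (below_card x) x
    have : g x = {(x, h.choose.1), (h.choose.2, x)} := by rw [hg]; simp only [step, dif_pos h]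
    rw [this]
    exact ⟨h.choose_spec, ⟨_, Or.inl rfl⟩, ⟨_, Or.inr rfl⟩⟩
  have elem_below : ∀ x, IsElemRel L (below x) := fun x =>
    wo.wf.induction x fun x ih => elem_union _ fun y hy => (elem_step y (ih y hy)).1
  obtain ⟨f, hf⟩ := (elem_union (fun _ => True)
    fun y _ => (elem_step y (elem_below y)).1).exists_equiv
    (fun x => (elem_step x (elem_below x)).2.1.imp fun y hy =>
      Or.inr (mem_iUnion₂.2 ⟨x, trivial, hy⟩))
    (fun x => (elem_step x (elem_below x)).2.2.imp fun y hy =>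
      Or.inr (mem_iUnion₂.2 ⟨x, trivial, hy⟩))
  exact ⟨f, fun r hr => hf r (Or.inl hr)⟩

end Homogeneity

section Coheir

variable {L U} {n : ℕ}

theorem exists_coheir (M : L.ElementarySubstructure U) (a : Fin n → U) :
    ∃ F : Ultrafilter (Fin n → M), ∀ φ : L.Formula (M ⊕ Fin n),
      φ.Realize (Sum.elim Subtype.val a) →
        ∀ᶠ m : Fin n → M in F, φ.Realize (Sum.elim Subtype.val fun i => (m i : U)) := by
  classical
  let B : L.Formula (M ⊕ Fin n) → Set (Fin n → M) := fun φ =>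
    {m | φ.Realize (Sum.elim Subtype.val fun i => (m i : U))}
  let G : Filter (Fin n → M) :=
    Filter.generate (B '' {φ | φ.Realize (Sum.elim Subtype.val a)})
  have : G.NeBot := by
    refine Filter.generate_neBot_iff.2 fun t ht hfin => ?_
    lift t to Finset (Set (Fin n → M)) using hfin
    obtain ⟨s, hs, rfl⟩ := Finset.subset_set_image_iff.1 ht
    have h : (Formula.iExs (Fin n) (Formula.iInf fun φ : s => φ.1)).Realize
        (Subtype.val : M → U) := by
      rw [Formula.realize_iExs]
      exact ⟨a, Formula.realize_iInf.2 fun φ => hs φ.2⟩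
    have h := (M.subtype.map_formula _ id).1 h
    rw [Formula.realize_iExs] at h
    obtain ⟨m, hm⟩ := h
    refine ⟨m, ?_⟩
    rintro _ hX
    obtain ⟨φ, hφ, rfl⟩ := Finset.mem_image.1 hX
    have h := (M.subtype.map_formula _ _).2 (Formula.realize_iInf.1 hm ⟨φ, hφ⟩)
    rwa [Sum.comp_elim] at h
  exact ⟨Ultrafilter.of G, fun φ hφ =>
    Ultrafilter.of_le G (Filter.GenerateSets.basic (mem_image_of_mem B hφ))⟩

theorem IsSatStr.exists_realize_coheir (hsat : IsSatStr U iS) (hinf : ℵ₀ ≤ #U)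
    {M : L.ElementarySubstructure U} (hM : #M < #U) (F : Ultrafilter (Fin n → M))
    {S : Set (Fin n → U)} (hS : #S < #U) :
    ∃ c : Fin n → U, ∀ s ∈ S, ∀ φ : L.Formula ((M ⊕ Fin n) ⊕ Fin n),
      φ.Realize (Sum.elim (Sum.elim Subtype.val s) c) ↔
        ∀ᶠ m : Fin n → M in F, φ.Realize (Sum.elim (Sum.elim Subtype.val s) fun i => (m i : U)) := by
  let e : M ⊕ (S × Fin n) → U := Sum.elim Subtype.val fun q => q.1.1 q.2
  have hI : #(M ⊕ (S × Fin n)) < #U := by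
    rw [mk_sum, lift_id, lift_id, mk_prod]
    refine add_lt_of_lt hinf hM (mul_lt_of_lt hinf (by simpa using hS) ?_)
    simpa using (natCast_lt_aleph0 (n := n)).trans_le hinf
  obtain ⟨c, hc⟩ := hsat.exists_realize hI e
    {φ | ∀ᶠ m : Fin n → M in F, φ.Realize (Sum.elim e fun i => (m i : U))} fun s hs => by
      have : ∀ᶠ m : Fin n → M in F, ∀ φ ∈ s, φ.Realize (Sum.elim e fun i => (m i : U)) :=
        (Filter.eventually_all_finset s).2 fun φ hφ => hs hφ
      obtain ⟨m, hm⟩ := this.exists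
      exact ⟨_, hm⟩
  have hc' : ∀ φ : L.Formula ((M ⊕ (S × Fin n)) ⊕ Fin n), φ.Realize (Sum.elim e c) ↔
      ∀ᶠ m : Fin n → M in F, φ.Realize (Sum.elim e fun i => (m i : U)) := by
    refine fun φ => ⟨fun h => ?_, hc φ⟩
    by_contra h'
    exact Formula.realize_not.1 (hc φ.not (Ultrafilter.eventually_not.2 h')) h
  refine ⟨c, fun s hs φ => ?_⟩
  have h := hc' (φ.relabel (Sum.map (Sum.map id fun i => (⟨s, hs⟩, i)) id))
  simp only [Formula.realize_relabel, Sum.elim_comp_map, e] at h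
  exact h

/-- A function with few values whose kernel is invariant under automorphisms fixing the small
model `M` is constant on types over `M`. -/
theorem IsSatStr.eq_of_realize_iff (hsat : IsSatStr U iS) (hinf : ℵ₀ < #U)
    {M : L.ElementarySubstructure U} (hM : #M < #U) {X : Type u} (hX : #X < #U)
    {T : (Fin n → U) → X}
    (hT : ∀ f ∈ AutFix L U (M : Set U), ∀ b b', T b = T b' → T (f ∘ b) = T (f ∘ b'))
    {a b : Fin n → U} (hab : ∀ φ : L.Formula (M ⊕ Fin n),
      φ.Realize (Sum.elim Subtype.val a) ↔ φ.Realize (Sum.elim Subtype.val b)) :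
    T a = T b := by
  classical
  let P : Set (Fin n → U) := {c | ∀ φ : L.Formula (M ⊕ Fin n),
      φ.Realize (Sum.elim Subtype.val a) ↔ φ.Realize (Sum.elim Subtype.val c)}
  let r : X → Fin n → U := fun x => if h : ∃ c ∈ P, T c = x then h.choose else a
  have hrP : ∀ x, r x ∈ P := by
    intro x
    dsimp only [r]
    split_ifs with h
    · exact h.choose_spec.1
    · exact fun _ => Iff.rfl
  have hrT : ∀ c ∈ P, T (r (T c)) = T c := by
    intro c hc
    have h : ∃ d ∈ P, T d = T c := ⟨c, hc, rfl⟩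
    simp only [r, dif_pos h]
    exact h.choose_spec.2
  let S : Set (Fin n → U) := range r ∪ {a, b}
  have hSP : S ⊆ P := by
    rintro s (⟨x, rfl⟩ | rfl | rfl)
    exacts [hrP x, fun _ => Iff.rfl, hab]
  have hS : #S < #U := (mk_union_le _ _).trans_lt (add_lt_of_lt hinf.le (mk_range_le.trans_lt hX)
    (((finite_singleton b).insert a).lt_aleph0.trans hinf))
  obtain ⟨F, hF⟩ := exists_coheir M a
  obtain ⟨c, hc⟩ := hsat.exists_realize_coheir hinf.le hM F hS
  have haS : a ∈ S := Or.inr (Or.inl rfl)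
  have hcP : c ∈ P := by
    have key : ∀ φ : L.Formula (M ⊕ Fin n), φ.Realize (Sum.elim Subtype.val a) →
        φ.Realize (Sum.elim Subtype.val c) := by
      intro φ h
      have := hc a haS (φ.relabel (Sum.map Sum.inl id))
      simp only [Formula.realize_relabel, Sum.elim_comp_map] at this
      exact this.2 (hF φ h)
    refine fun φ => ⟨key φ, fun h => ?_⟩
    by_contra h'
    exact Formula.realize_not.1 (key φ.not (Formula.realize_not.2 h')) h
  have hTc : ∀ s ∈ S, T s = T c := by
    intro s hs
    have hr : r (T c) ∈ S := Or.inl ⟨_, rfl⟩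
    have hel : ∀ φ : L.Formula ((M ⊕ Fin n) ⊕ Fin n),
        φ.Realize (Sum.elim (Sum.elim Subtype.val (r (T c))) c) ↔
          φ.Realize (Sum.elim (Sum.elim Subtype.val s) c) := by
      intro φ
      rw [hc _ hr, hc _ hs]
      refine Filter.eventually_congr (Filter.Eventually.of_forall fun m => ?_)
      have := (hSP hr (φ.relabel (Sum.elim id fun i => Sum.inl (m i)))).symm.trans
        (hSP hs (φ.relabel (Sum.elim id fun i => Sum.inl (m i))))
      simp only [Formula.realize_relabel, Sum.comp_elim] at this
      exact this
    obtain ⟨f, hf⟩ := (isElemRel_range hel).exists_automorphism hsat hinf (by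
      refine mk_range_le.trans_lt ?_
      rw [mk_sum, mk_sum]
      have : (n : Cardinal.{u}) < #U := natCast_lt_aleph0.trans hinf
      simpa using add_lt_of_lt hinf.le (add_lt_of_lt hinf.le hM this) this)
    have h1 : f ∘ r (T c) = s := funext fun i => hf _ ⟨Sum.inl (Sum.inr i), rfl⟩
    have h2 : f ∘ c = c := funext fun i => hf _ ⟨Sum.inr i, rfl⟩
    have := hT f (fun m hm => hf _ ⟨Sum.inl (Sum.inl ⟨m, hm⟩), rfl⟩) _ _ (hrT c hcP)
    rwa [h1, h2] at this
  exact (hTc a haS).trans (hTc b (Or.inr (Or.inr rfl))).symm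

end Coheir

section Counting

theorem aleph0_le_mk_sigma_formula (L' : FirstOrder.Language.{u, u}) :
    ℵ₀ ≤ #(Σ k : ℕ, L'.Formula (Fin k)) := by
  rw [aleph0_le_mk_iff]
  exact Infinite.of_injective (fun k => ⟨k, ⊥⟩) fun k l h => congrArg Sigma.fst h

theorem card_le_card_sigma_formula (L' : FirstOrder.Language.{u, u}) :
    L'.card ≤ #(Σ k : ℕ, L'.Formula (Fin k)) := by
  have hinf := aleph0_le_mk_sigma_formula L'
  rw [card_eq_card_functions_add_card_relations]
  simp only [lift_id, ← mk_sigma]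
  refine add_le_of_le hinf (mk_le_of_injective (f := fun f => ⟨f.1,
    Term.equal (Term.func f.2 Term.var) (Term.func f.2 Term.var)⟩) ?_)
    (mk_le_of_injective (f := fun r => ⟨r.1, r.2.formula Term.var⟩) ?_)
  · rintro ⟨k, f⟩ ⟨l, g⟩ h
    simp only [Sigma.mk.injEq] at h
    obtain ⟨rfl, h⟩ := h
    simpa [Term.equal, Term.bdEqual, Term.relabel] using h
  · rintro ⟨k, f⟩ ⟨l, g⟩ h
    simp only [Sigma.mk.injEq] at h
    obtain ⟨rfl, h⟩ := h
    simpa [Relations.formula, Relations.boundedFormula] using h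

theorem mk_formula_le (L' : FirstOrder.Language.{u, u}) (α : Type*) :
    #(L'.Formula α) ≤ max ℵ₀ (lift.{u} #α + lift L'.card) := by
  refine (mk_le_of_injective (f := fun φ => (⟨0, φ⟩ : Σ k, L'.BoundedFormula α k)) ?_).trans
    (by simpa using BoundedFormula.card_le (L := L') (α := α))
  exact fun φ ψ h => by simpa using h

theorem mk_sigma_formula_le (L' : FirstOrder.Language.{u, u}) :
    #(Σ k : ℕ, L'.Formula (Fin k)) ≤ max ℵ₀ L'.card := by
  have hfiber : ∀ k : ℕ, #(L'.Formula (Fin k)) ≤ max ℵ₀ L'.card := fun k => by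
    refine (mk_formula_le L' (Fin k)).trans (max_le (le_max_left _ _) ?_)
    refine add_le_of_le (le_max_left _ _) ?_ (by simp)
    simp
  rw [mk_sigma]
  refine (sum_le_lift_mk_mul_iSup _).trans (mul_le_of_le (le_max_left _ _) (by simp) ?_)
  exact ciSup_le' hfiber

end Counting

theorem mem_imgSet_comp {n : ℕ} (f g : U ≃[L] U) (D : Set (Fin n → U)) (b : Fin n → U) :
    f ∘ b ∈ imgSet L U g D ↔ b ∈ imgSet L U (f.symm.comp g) D := by
  constructor
  · rintro ⟨d, hd, h⟩
    refine ⟨d, hd, ?_⟩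
    funext i
    simpa using congrArg f.symm (congrFun h i)
  · rintro ⟨d, hd, rfl⟩
    refine ⟨d, hd, ?_⟩
    funext i
    simp

variable {L U} in
theorem mem_iff_mem_of_realize_iff (hsat : IsSatStr U iS) (hinacc : IsInaccessible #U)
    {n : ℕ} {D : Set (Fin n → U)} {A : Set U} (ho : #(oSet L U A D) < #U)
    {M : L.ElementarySubstructure U} (hAM : A ⊆ M) (hM : #M < #U)
    {a b : Fin n → U} (hab : ∀ φ : L.Formula (M ⊕ Fin n),
      φ.Realize (Sum.elim Subtype.val a) ↔ φ.Realize (Sum.elim Subtype.val b))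
    {C : Set (Fin n → U)} (hC : C ∈ oSet L U A D) : a ∈ C ↔ b ∈ C := by
  have h := hsat.eq_of_realize_iff hinacc.aleph0_lt hM (X := Set (oSet L U A D))
    (by rw [mk_set]; exact hinacc.isStrongPrelimit ho)
    (T := fun d => {C | d ∈ C.1}) ?_ hab
  · exact iff_of_eq (congrArg (fun S => (⟨C, hC⟩ : oSet L U A D) ∈ S) h)
  · intro f hf d d' hdd
    ext ⟨_, g, hg, rfl⟩
    have hfg : imgSet L U (f.symm.comp g) D ∈ oSet L U A D := by
      refine ⟨_, fun x hx => ?_, rfl⟩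
      rw [Language.Equiv.comp_apply, hg x hx]
      exact (congrArg f.symm (hf x (hAM hx)).symm).trans (f.symm_apply_apply x)
    have := iff_of_eq (congrArg (fun S => (⟨_, hfg⟩ : oSet L U A D) ∈ S) hdd)
    exact (mem_imgSet_comp L U f g D d).trans (this.trans (mem_imgSet_comp L U f g D d').symm)

/-- the orbit `o(D/A)` has cardinality `< κ` iff it has cardinality
`≤ 2 ^ 2 ^ |L(A)|`. -/
theorem stmt14 (L : FirstOrder.Language.{u, u}) (U : Type u) [iS : L.Structure U]
    (hsat : IsSatStr U iS) (hinacc : Cardinal.IsInaccessible #U) (hcard : L.card < #U)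
    (n : ℕ) (D : Set (Fin n → U)) (A : Set U) (hA : #A < #U) :
    (#(oSet L U A D) < #U ↔
      #(oSet L U A D) ≤ (2 : Cardinal.{u}) ^ ((2 : Cardinal.{u}) ^ formulaCard L U A)) := by
  have hL : (L[[↥A]]).card = L.card + #A := by
    rw [card_withConstants, lift_id, lift_id]
  have hLA : L.card + #A ≤ formulaCard L U A := hL ▸ card_le_card_sigma_formula (L[[↥A]])
  have hlt : formulaCard L U A < #U := (mk_sigma_formula_le (L[[↥A]])).trans_lt
    (max_lt hinacc.aleph0_lt (hL ▸ add_lt_of_lt hinacc.aleph0_lt.le hcard hA))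
  have hinf : ℵ₀ ≤ formulaCard L U A := aleph0_le_mk_sigma_formula (L[[↥A]])
  refine ⟨fun ho => ?_, fun h => h.trans_lt
    (hinacc.isStrongPrelimit (hinacc.isStrongPrelimit hlt))⟩
  obtain ⟨M, hAM, hM⟩ := exists_elementarySubstructure_card_eq L A (formulaCard L U A) hinf
    (by simpa using le_add_self.trans hLA) (by simpa using le_self_add.trans hLA)
    (by simpa using hlt.le)
  rw [lift_id, lift_id] at hM
  let tp : (Fin n → U) → Set (L.Formula (M ⊕ Fin n)) :=
    fun a => {φ | φ.Realize (Sum.elim Subtype.val a)}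
  have hinj : Function.Injective fun C : oSet L U A D => tp '' C.1 := by
    have key : ∀ C C' : oSet L U A D, tp '' C.1 = tp '' C'.1 → C.1 ⊆ C'.1 := by
      intro C C' h a ha
      obtain ⟨b, hb, hba⟩ := h ▸ mem_image_of_mem tp ha
      exact (mem_iff_mem_of_realize_iff hsat hinacc ho hAM (hM ▸ hlt)
        (fun φ => iff_of_eq (congrArg (φ ∈ ·) hba)) C'.2).1 hb
    exact fun C C' h => Subtype.ext ((key C C' h).antisymm (key C' C h.symm))
  refine (mk_le_of_injective hinj).trans ?_
  rw [mk_set, mk_set]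
  have hcount : #(L.Formula (M ⊕ Fin n)) ≤ formulaCard L U A := by
    refine (mk_formula_le L _).trans (max_le hinf ?_)
    rw [mk_sum, hM]
    have : (n : Cardinal.{u}) ≤ formulaCard L U A := natCast_le_aleph0.trans hinf
    simpa using add_le_of_le hinf (add_le_of_le hinf le_rfl this) (le_self_add.trans hLA)
  exact power_le_power_left two_ne_zero (power_le_power_left two_ne_zero hcount)


end Paper
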